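/- arXiv:2211.12686 — 11 statements merged into one kernel-verified Lean document; each statement's English description precedes it below -/
import Mathlib

section
/- Let ε ≥ 0 and g > 0, and let (μ_B, μ_U) be a pair of Borel probability measures on ℝ that is (ε/2, g)-one-sided indistinguishable. Then for every t₀ ∈ [0, g] and every Borel set A ⊆ ℝ × ℝ, the product measure satisfies (μ_B ⊗ μ_B)(A) ≤ exp(ε) · (μ_U ⊗ ν)(A), where ν is the pushforward of μ_U under the translation t ↦ t + t₀. (This is the distributional content of the privacy guarantee of the randomized delay mechanism: the joint law of the posting offsets of a batched pair of comments is within a factor exp(ε) of the joint law of the posting offsets of an unbatched pair arriving t₀ apart.) -/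
open MeasureTheory Set Real

/-- A pair of Borel probability measures on ℝ, each giving measure zero to (−∞,0),
is (ε,g)-one-sided indistinguishable if for every Borel set S and every t₀ ∈ [0,g],
μB(S) ≤ exp(ε) · μU(S − t₀), where S − t₀ = {s − t₀ : s ∈ S} = (· + t₀)⁻¹' S. -/
def OSIndist (ε g : ℝ) (μB μU : Measure ℝ) : Prop :=
  μB (Set.Iio 0) = 0 ∧ μU (Set.Iio 0) = 0 ∧
  ∀ S : Set ℝ, MeasurableSet S → ∀ t₀ ∈ Set.Icc (0 : ℝ) g,
    μB S ≤ ENNReal.ofReal (Real.exp ε) * μU ((· + t₀) ⁻¹' S)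

/-- Setwise domination by a finite multiple passes to the product of two pairs of measures. -/
theorem prod_le_mul_prod_of_le_smul {α β : Type*} [MeasurableSpace α] [MeasurableSpace β]
    {μ μ' : Measure α} {ν ν' : Measure β} [SFinite ν']
    {a b : ENNReal} (hμ : μ ≤ a • μ') (hν : ν ≤ b • ν') (A : Set (α × β)) :
    (μ.prod ν) A ≤ a * b * (μ'.prod ν') A := by
  calc (μ.prod ν) A ≤ ((a • μ').prod (b • ν')) A := Measure.prod_mono hμ hν A
    _ = a * b * (μ'.prod ν') A := by
      rw [Measure.prod_smul_left, Measure.prod_smul_right]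
      simp [mul_assoc]

theorem stmt0 (ε g : ℝ) (hε : 0 ≤ ε) (hg : 0 < g) (μB μU : Measure ℝ)
    [IsProbabilityMeasure μB] [IsProbabilityMeasure μU]
    (h : OSIndist (ε / 2) g μB μU) :
    ∀ t₀ ∈ Set.Icc (0 : ℝ) g, ∀ A : Set (ℝ × ℝ), MeasurableSet A →
      (μB.prod μB) A ≤ ENNReal.ofReal (Real.exp ε) * (μU.prod (μU.map (· + t₀))) A := by
  obtain ⟨-, -, h⟩ := h
  intro t₀ ht₀ A _
  have hU : μB ≤ ENNReal.ofReal (exp (ε / 2)) • μU :=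
    Measure.le_iff.2 fun S hS => by simpa using h S hS 0 ⟨le_rfl, hg.le⟩
  have hU' : μB ≤ ENNReal.ofReal (exp (ε / 2)) • μU.map (· + t₀) :=
    Measure.le_iff.2 fun S hS => by
      simpa [Measure.map_apply (measurable_add_const t₀) hS] using h S hS t₀ ht₀
  have hexp : ENNReal.ofReal (exp ε) =
      ENNReal.ofReal (exp (ε / 2)) * ENNReal.ofReal (exp (ε / 2)) := by
    rw [← ENNReal.ofReal_mul (exp_pos _).le, ← exp_add, add_halves]
  rw [hexp]
  exact prod_le_mul_prod_of_le_smul hU hU' A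
end

section
/- For every ε > 0 and g > 0, the pair (g + Exp(ε/g), Exp(ε/g)) — that is, μ_B equal to the exponential distribution with rate ε/g translated by g, and μ_U equal to the exponential distribution with rate ε/g — is (ε, g)-one-sided indistinguishable. -/
open MeasureTheory Set Real

/-- The exponential distribution with rate `lam`: density `lam · exp(−lam·t)` on `[0,∞)`. -/
noncomputable def expMeasure (lam : ℝ) : Measure ℝ :=
  volume.withDensity fun t => if t < 0 then 0 else ENNReal.ofReal (lam * Real.exp (-lam * t))

/-- The density of the exponential distribution with rate `lam`. -/
noncomputable def expDensity (lam t : ℝ) : ENNReal :=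
  if t < 0 then 0 else ENNReal.ofReal (lam * Real.exp (-lam * t))

lemma expMeasure_eq_withDensity (lam : ℝ) :
    expMeasure lam = volume.withDensity (expDensity lam) := rfl

lemma measurable_expDensity (lam : ℝ) : Measurable (expDensity lam) :=
  Measurable.ite measurableSet_Iio measurable_const (by fun_prop)

lemma measurable_expDensity_sub (lam c : ℝ) : Measurable fun x => expDensity lam (x - c) :=
  (measurable_expDensity lam).comp (measurable_sub_const c)

lemma expMeasure_Iio_of_nonpos (lam : ℝ) {a : ℝ} (ha : a ≤ 0) :
    expMeasure lam (Set.Iio a) = 0 := by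
  rw [expMeasure_eq_withDensity, withDensity_apply _ measurableSet_Iio]
  refine setLIntegral_eq_zero measurableSet_Iio fun t ht => ?_
  exact if_pos (lt_of_lt_of_le ht ha)

lemma expMeasure_preimage_add_right (lam c : ℝ) {S : Set ℝ} (hS : MeasurableSet S) :
    expMeasure lam ((· + c) ⁻¹' S) = ∫⁻ x in S, expDensity lam (x - c) := by
  rw [expMeasure_eq_withDensity, withDensity_apply _ (measurable_add_const c hS),
    ← (measurePreserving_add_right volume c).setLIntegral_comp_preimage hS
      (measurable_expDensity_sub lam c)]
  simp

/-- Translating the exponential density to the left by `g - t₀` costs a factor at most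
`exp (lam * g)`. -/
lemma expDensity_sub_le {lam g t₀ : ℝ} (hlam : 0 ≤ lam) (ht₀ : t₀ ∈ Set.Icc 0 g) (x : ℝ) :
    expDensity lam (x - g) ≤
      ENNReal.ofReal (Real.exp (lam * g)) * expDensity lam (x - t₀) := by
  obtain ⟨h0, hg⟩ := ht₀
  unfold expDensity
  by_cases hx : x - g < 0
  · simp [hx]
  · rw [if_neg hx, if_neg (by linarith), ← ENNReal.ofReal_mul (Real.exp_nonneg _)]
    refine ENNReal.ofReal_le_ofReal ?_
    rw [mul_left_comm, ← Real.exp_add]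
    gcongr
    nlinarith [mul_nonneg hlam h0]

theorem stmt1 (ε g : ℝ) (hε : 0 < ε) (hg : 0 < g) :
    OSIndist ε g ((expMeasure (ε / g)).map (· + g)) (expMeasure (ε / g)) := by
  refine ⟨?_, expMeasure_Iio_of_nonpos _ le_rfl, fun S hS t₀ ht₀ => ?_⟩
  · rw [Measure.map_apply (measurable_add_const g) measurableSet_Iio,
      Set.preimage_add_const_Iio]
    exact expMeasure_Iio_of_nonpos _ (by linarith)
  · rw [Measure.map_apply (measurable_add_const g) hS, expMeasure_preimage_add_right _ _ hS,
      expMeasure_preimage_add_right _ _ hS,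
      ← lintegral_const_mul _ (measurable_expDensity_sub _ t₀)]
    refine lintegral_mono fun x => ?_
    simpa [div_mul_cancel₀ ε hg.ne'] using expDensity_sub_le (div_pos hε hg).le ht₀ x
end

section
/- For every ε > 0 and g > 0, the pair (Unif(g, g/(1 − e^{−ε})), Unif(0, g/(1 − e^{−ε}))) is (ε, g)-one-sided indistinguishable. -/
open MeasureTheory Set Real

/-- The uniform probability measure on `[a,b]` (density `1/(b−a)` on `[a,b]`). -/
noncomputable def unif (a b : ℝ) : Measure ℝ :=
  (ENNReal.ofReal (b - a))⁻¹ • volume.restrict (Set.Icc a b)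

lemma unif_Iio_zero {a : ℝ} (ha : 0 ≤ a) (b : ℝ) : unif a b (Set.Iio 0) = 0 := by
  have h : Set.Iio (0 : ℝ) ∩ Set.Icc a b = ∅ := by
    ext x
    simp only [Set.mem_inter_iff, Set.mem_Iio, Set.mem_Icc, Set.mem_empty_iff_false, iff_false]
    rintro ⟨h₁, h₂, -⟩
    linarith
  simp [unif, Measure.restrict_apply measurableSet_Iio, h]

lemma volume_inter_Icc_le_preimage_add {g t : ℝ} (ht : t ∈ Set.Icc 0 g) (b : ℝ) (S : Set ℝ) :
    volume (S ∩ Set.Icc g b) ≤ volume ((· + t) ⁻¹' S ∩ Set.Icc 0 b) := by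
  rw [← measure_preimage_add_right volume t (S ∩ Set.Icc g b)]
  refine measure_mono ?_
  rintro x ⟨hS, h₁, h₂⟩
  have := ht.1
  have := ht.2
  exact ⟨hS, by linarith, by linarith⟩

theorem stmt2 (ε g : ℝ) (hε : 0 < ε) (hg : 0 < g) :
    OSIndist ε g (unif g (g / (1 - Real.exp (-ε)))) (unif 0 (g / (1 - Real.exp (-ε)))) := by
  have hd : 0 < 1 - Real.exp (-ε) := by
    have : Real.exp (-ε) < 1 := by simpa using hε
    linarith
  set T := g / (1 - Real.exp (-ε)) with hT
  have hT₀ : 0 < T := div_pos hg hd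
  have hTg : T - g = Real.exp (-ε) * T := by
    have : T * (1 - Real.exp (-ε)) = g := div_mul_cancel₀ g hd.ne'
    linarith
  refine ⟨unif_Iio_zero hg.le T, unif_Iio_zero le_rfl T, fun S hS t₀ ht₀ => ?_⟩
  have hpre : MeasurableSet ((· + t₀) ⁻¹' S) := measurable_add_const t₀ hS
  have hdens : (ENNReal.ofReal (T - g))⁻¹ =
      ENNReal.ofReal (Real.exp ε) * (ENNReal.ofReal (T - 0))⁻¹ := by
    rw [sub_zero, hTg, ← ENNReal.ofReal_inv_of_pos (by positivity),
      ← ENNReal.ofReal_inv_of_pos hT₀, ← ENNReal.ofReal_mul (Real.exp_pos ε).le, mul_inv,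
      ← Real.exp_neg, neg_neg]
  simp only [unif, Measure.smul_apply, smul_eq_mul, Measure.restrict_apply hS,
    Measure.restrict_apply hpre]
  rw [hdens, mul_assoc]
  gcongr _ * (_ * ?_)
  exact volume_inter_Icc_le_preimage_add ht₀ T S
end

section
/- Let ε > 0, g > 0 and λ > 0. The pair (g + Exp(λ), Exp(λ)) — the exponential distribution with rate λ translated by g, paired with the exponential distribution with rate λ — is (ε, g)-one-sided indistinguishable if and only if λ·g ≤ ε. Consequently, among all such shifted-exponential pairs that are (ε, g)-one-sided indistinguishable, the means g + 1/λ and 1/λ are simultaneously minimized by the choice λ = ε/g, giving means g·(1 + 1/ε) and g/ε. -/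
open MeasureTheory Set Real

theorem expMeasure_eq_probabilityTheory_expMeasure (lam : ℝ) :
    expMeasure lam = ProbabilityTheory.expMeasure lam := by
  unfold expMeasure ProbabilityTheory.expMeasure ProbabilityTheory.gammaMeasure
  congr 1
  funext t
  change _ = ProbabilityTheory.exponentialPDF lam t
  split_ifs with h
  · exact (ProbabilityTheory.exponentialPDF_of_neg h).symm
  · rw [ProbabilityTheory.exponentialPDF_of_nonneg (not_lt.1 h), neg_mul]

theorem isProbabilityMeasure_expMeasure {lam : ℝ} (hlam : 0 < lam) :
    IsProbabilityMeasure (expMeasure lam) := by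
  rw [expMeasure_eq_probabilityTheory_expMeasure]
  exact ProbabilityTheory.isProbabilityMeasure_expMeasure hlam

theorem expMeasure_Iio_zero (lam : ℝ) : expMeasure lam (Iio 0) = 0 := by
  rw [expMeasure, withDensity_apply _ measurableSet_Iio]
  exact setLIntegral_eq_zero measurableSet_Iio fun t ht => if_pos ht

theorem expMeasure_Ici_zero {lam : ℝ} (hlam : 0 < lam) : expMeasure lam (Ici 0) = 1 := by
  have := isProbabilityMeasure_expMeasure hlam
  rw [← compl_Iio, prob_compl_eq_one_iff measurableSet_Iio]
  exact expMeasure_Iio_zero lam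

/-- Memorylessness of the exponential distribution. -/
theorem expMeasure_preimage_add (lam : ℝ) {c : ℝ} (hc : 0 ≤ c) {T : Set ℝ}
    (hT : MeasurableSet T) :
    expMeasure lam ((· + c) ⁻¹' T) =
      ENNReal.ofReal (Real.exp (lam * c)) * expMeasure lam (T ∩ Ici c) := by
  have hTc : MeasurableSet (T ∩ Ici c) := hT.inter measurableSet_Ici
  have hpre : MeasurableSet ((· + c) ⁻¹' T) := measurable_add_const c hT
  rw [expMeasure, withDensity_apply _ hpre, withDensity_apply _ hTc,
    ← lintegral_indicator hpre, ← lintegral_indicator hTc,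
    ← lintegral_add_right_eq_self ((T ∩ Ici c).indicator _) c,
    ← lintegral_const_mul' _ _ ENNReal.ofReal_ne_top]
  congr 1
  funext x
  by_cases hx : x + c ∈ T
  · rw [indicator_of_mem (show x ∈ (· + c) ⁻¹' T from hx)]
    rcases lt_or_ge x 0 with h0 | h0
    · rw [if_pos h0, indicator_of_notMem (fun h => by have := mem_Ici.1 h.2; linarith), mul_zero]
    · have hmem : x + c ∈ T ∩ Ici c := ⟨hx, mem_Ici.2 (by linarith)⟩
      rw [if_neg h0.not_gt, indicator_of_mem hmem,
        if_neg (by linarith), ← ENNReal.ofReal_mul (Real.exp_nonneg _), mul_left_comm,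
        ← Real.exp_add]
      ring_nf
  · rw [indicator_of_notMem (show x ∉ (· + c) ⁻¹' T from hx),
      indicator_of_notMem (fun h => hx h.1), mul_zero]

theorem osIndist_expMeasure_iff {ε g lam : ℝ} (hg : 0 < g) (hlam : 0 < lam) :
    OSIndist ε g ((expMeasure lam).map (· + g)) (expMeasure lam) ↔ lam * g ≤ ε := by
  have map_apply {S : Set ℝ} (hS : MeasurableSet S) :
      (expMeasure lam).map (· + g) S = expMeasure lam ((· + g) ⁻¹' S) :=
    Measure.map_apply (measurable_add_const g) hS
  constructor
  · rintro ⟨-, -, h⟩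
    have hIci := h (Ici g) measurableSet_Ici 0 ⟨le_rfl, hg.le⟩
    have hshift := expMeasure_preimage_add lam hg.le (measurableSet_Ici (a := g))
    rw [map_apply measurableSet_Ici] at hIci
    simp only [preimage_add_const_Ici, sub_self, sub_zero, inter_self,
      expMeasure_Ici_zero hlam] at hIci hshift
    rw [hshift] at hIci
    have hpos : expMeasure lam (Ici g) ≠ 0 := fun h0 => by simp [h0] at hshift
    have := isProbabilityMeasure_expMeasure hlam
    have hexp := (ENNReal.mul_le_mul_iff_left hpos (measure_ne_top _ _)).1 hIci
    exact Real.exp_le_exp.1 ((ENNReal.ofReal_le_ofReal_iff (Real.exp_nonneg _)).1 hexp)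
  · intro h
    refine ⟨?_, expMeasure_Iio_zero lam, fun S hS t₀ ht => ?_⟩
    · rw [map_apply measurableSet_Iio, preimage_add_const_Iio]
      exact measure_mono_null (Iio_subset_Iio (by linarith)) (expMeasure_Iio_zero lam)
    · have hcomp : (· + g) ⁻¹' S = (· + (g - t₀)) ⁻¹' ((· + t₀) ⁻¹' S) := by
        ext x
        simp [add_assoc]
      rw [map_apply hS, hcomp, expMeasure_preimage_add lam (sub_nonneg.2 ht.2)
        (measurable_add_const t₀ hS)]
      gcongr
      · nlinarith [ht.1]
      · exact inter_subset_left

theorem stmt5 (ε g lam : ℝ) (hε : 0 < ε) (hg : 0 < g) (hlam : 0 < lam) :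
    (OSIndist ε g ((expMeasure lam).map (· + g)) (expMeasure lam) ↔ lam * g ≤ ε) ∧
    (OSIndist ε g ((expMeasure lam).map (· + g)) (expMeasure lam) →
      g * (1 + 1 / ε) ≤ g + 1 / lam ∧ g / ε ≤ 1 / lam) ∧
    OSIndist ε g ((expMeasure (ε / g)).map (· + g)) (expMeasure (ε / g)) := by
  have hdiv : 0 < ε / g := div_pos hε hg
  refine ⟨osIndist_expMeasure_iff hg hlam, fun h => ?_,
    (osIndist_expMeasure_iff hg hdiv).2 (div_mul_cancel₀ ε hg.ne').le⟩
  have hle : g / ε ≤ 1 / lam := by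
    rw [div_le_div_iff₀ hε hlam]
    linarith [(osIndist_expMeasure_iff hg hlam).1 h]
  refine ⟨?_, hle⟩
  rw [mul_add, mul_one, mul_one_div]
  gcongr
end

section
/- Let ε ≥ 0 and g > 0. Suppose μ_B is the pushforward of a Borel probability measure μ_{B₀} on [0,∞) under t ↦ t + c_B, and μ_U is the pushforward of a Borel probability measure μ_{U₀} on [0,∞) under t ↦ t + c_U, where c_B, c_U > 0 and μ_{B₀}([0,δ)) > 0 for every δ > 0. If the pair (μ_B, μ_U) satisfies the (ε,g)-product condition, then c_B − c_U ≥ g. -/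
open MeasureTheory Set Real

/-- The (ε,g)-product condition: for all Borel sets S, S' and all t₀ ∈ [0,g],
μB(S)·μB(S') ≤ exp(ε)·μU(S)·μU(S' − t₀). -/
def ProdCond (ε g : ℝ) (μB μU : Measure ℝ) : Prop :=
  μB (Set.Iio 0) = 0 ∧ μU (Set.Iio 0) = 0 ∧
  ∀ S S' : Set ℝ, MeasurableSet S → MeasurableSet S' → ∀ t₀ ∈ Set.Icc (0 : ℝ) g,
    μB S * μB S' ≤ ENNReal.ofReal (Real.exp ε) * (μU S * μU ((· + t₀) ⁻¹' S'))

theorem stmt6 (ε g cB cU : ℝ) (hε : 0 ≤ ε) (hg : 0 < g) (hcB : 0 < cB) (hcU : 0 < cU)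
    (μB₀ μU₀ : Measure ℝ) [IsProbabilityMeasure μB₀] [IsProbabilityMeasure μU₀]
    (hB₀ : μB₀ (Set.Iio 0) = 0) (hU₀ : μU₀ (Set.Iio 0) = 0)
    (hpos : ∀ δ : ℝ, 0 < δ → 0 < μB₀ (Set.Ico 0 δ))
    (h : ProdCond ε g (μB₀.map (· + cB)) (μU₀.map (· + cU))) :
    g ≤ cB - cU := by
  by_contra! hlt
  have hprod := h.2.2 univ (Ico cB (cU + g)) MeasurableSet.univ measurableSet_Ico g
    (right_mem_Icc.2 hg.le)
  have hmB : Measurable (· + cB : ℝ → ℝ) := by fun_prop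
  have hmU : Measurable (· + cU : ℝ → ℝ) := by fun_prop
  have hmg : Measurable (· + g : ℝ → ℝ) := by fun_prop
  have hU : μU₀.map (· + cU) ((· + g) ⁻¹' Ico cB (cU + g)) = 0 := by
    rw [Measure.map_apply hmU (hmg measurableSet_Ico)]
    refine measure_mono_null (fun x hx => ?_) hU₀
    simp only [mem_preimage, mem_Ico, mem_Iio] at hx ⊢
    linarith [hx.2]
  have hB : μB₀.map (· + cB) (Ico cB (cU + g)) = μB₀ (Ico 0 (cU + g - cB)) := by
    rw [Measure.map_apply hmB measurableSet_Ico, preimage_add_const_Ico, sub_self]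
  rw [hU, hB, Measure.map_apply hmB MeasurableSet.univ, preimage_univ, measure_univ, one_mul,
    mul_zero, mul_zero] at hprod
  exact (hpos (cU + g - cB) (by linarith)).not_ge hprod
end

section
/- Let ε ≥ 0, g > 0, and let (μ_B, μ_U) be an (ε, g)-one-sided indistinguishable pair of Borel probability measures supported on [0,∞). For each positive integer i, let μ_{B,i} and μ_{U,i} be the piecewise-constant approximations of μ_B and μ_U at scale g/i. Then (μ_{B,i}, μ_{U,i}) is also (ε, g)-one-sided indistinguishable. -/
open MeasureTheory Set Real

/-- The piecewise-constant approximation of a measure `μ` at scale `g/i`: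
the measure with Lebesgue density `f_i`, where `f_i(t) = (i/g)·μ([k·g/i, (k+1)·g/i))`
for `t ∈ [k·g/i, (k+1)·g/i)` (`k ∈ ℕ`) and `f_i(t) = 0` for `t < 0`. -/
noncomputable def pcApprox (g : ℝ) (i : ℕ) (μ : Measure ℝ) : Measure ℝ :=
  volume.withDensity fun t =>
    if t < 0 then 0
    else
      ENNReal.ofReal ((i : ℝ) / g) *
        μ (Set.Ico ((⌊t / (g / (i : ℝ))⌋ : ℝ) * (g / (i : ℝ)))
            (((⌊t / (g / (i : ℝ))⌋ : ℝ) + 1) * (g / (i : ℝ))))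

/-- The density of `pcApprox g i μ` with respect to Lebesgue measure. -/
noncomputable def pcDensity (g : ℝ) (i : ℕ) (μ : Measure ℝ) (t : ℝ) : ENNReal :=
  if t < 0 then 0
  else
    ENNReal.ofReal ((i : ℝ) / g) *
      μ (Set.Ico ((⌊t / (g / (i : ℝ))⌋ : ℝ) * (g / (i : ℝ)))
          (((⌊t / (g / (i : ℝ))⌋ : ℝ) + 1) * (g / (i : ℝ))))

lemma pcApprox_apply (g : ℝ) (i : ℕ) (μ : Measure ℝ) {S : Set ℝ} (hS : MeasurableSet S) :
    pcApprox g i μ S = ∫⁻ t in S, pcDensity g i μ t :=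
  withDensity_apply _ hS

lemma pcApprox_Iio_zero (g : ℝ) (i : ℕ) (μ : Measure ℝ) : pcApprox g i μ (Iio 0) = 0 := by
  rw [pcApprox_apply g i μ measurableSet_Iio]
  refine setLIntegral_eq_zero measurableSet_Iio fun t ht => ?_
  exact if_pos ht

/-- If `μ` gives no mass to `(-∞, 0)`, the density at every `t`, negative or not, is the mass of
the cell of `t` divided by the length of the cell. -/
lemma pcDensity_eq {g : ℝ} (hg : 0 < g) {i : ℕ} (hi : 0 < i) {μ : Measure ℝ}
    (hμ : μ (Iio 0) = 0) (t : ℝ) :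
    pcDensity g i μ t = ENNReal.ofReal ((i : ℝ) / g) *
      μ (Set.Ico ((⌊t / (g / (i : ℝ))⌋ : ℝ) * (g / (i : ℝ)))
          (((⌊t / (g / (i : ℝ))⌋ : ℝ) + 1) * (g / (i : ℝ)))) := by
  unfold pcDensity
  split_ifs with ht
  · have hδ : 0 < g / (i : ℝ) := by positivity
    have hfloor : ⌊t / (g / (i : ℝ))⌋ + 1 ≤ 0 :=
      Int.add_one_le_iff.2 (Int.floor_lt.2 (by simpa using div_neg_of_neg_of_pos ht hδ))
    have hcast : (⌊t / (g / (i : ℝ))⌋ : ℝ) + 1 ≤ 0 := by exact_mod_cast hfloor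
    rw [measure_mono_null _ hμ, mul_zero]
    intro x hx
    exact hx.2.trans_le (mul_nonpos_of_nonpos_of_nonneg hcast hδ.le)
  · rfl

lemma pcDensity_le {ε g : ℝ} (hg : 0 < g) {μB μU : Measure ℝ} (h : OSIndist ε g μB μU)
    {i : ℕ} (hi : 0 < i) {t₀ : ℝ} (ht₀ : t₀ ∈ Icc 0 g) (t : ℝ) :
    pcDensity g i μB (t + t₀) ≤ ENNReal.ofReal (Real.exp ε) * pcDensity g i μU t := by
  obtain ⟨hB, hU, hBU⟩ := h
  rw [pcDensity_eq hg hi hB, pcDensity_eq hg hi hU, mul_left_comm]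
  gcongr
  have hi' : (0 : ℝ) < i := by exact_mod_cast hi
  have hδ : 0 < g / (i : ℝ) := by positivity
  have hg' : g = i * (g / (i : ℝ)) := by field_simp
  set δ := g / (i : ℝ)
  set k := ⌊(t + t₀) / δ⌋
  set l := ⌊t / δ⌋
  have hlk : (l : ℝ) ≤ k := by
    exact_mod_cast Int.floor_mono (div_le_div_of_nonneg_right (by linarith [ht₀.1]) hδ.le)
  have hkl : (k : ℝ) ≤ l + i := by
    have hfloor : k ≤ ⌊t / δ + (i : ℕ)⌋ := by
      refine Int.floor_mono ?_
      rw [div_add' _ _ _ hδ.ne']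
      exact div_le_div_of_nonneg_right (by linarith [ht₀.2]) hδ.le
    rw [Int.floor_add_natCast] at hfloor
    exact_mod_cast hfloor
  have hshift : ((k : ℝ) - l) * δ ∈ Icc 0 g := by
    constructor
    · exact mul_nonneg (by linarith) hδ.le
    · rw [hg']
      exact mul_le_mul_of_nonneg_right (by linarith) hδ.le
  have hle := hBU _ (measurableSet_Ico (a := (k : ℝ) * δ) (b := (k + 1) * δ)) _ hshift
  rwa [Set.preimage_add_const_Ico, show (k : ℝ) * δ - (k - l) * δ = l * δ by ring,
    show ((k : ℝ) + 1) * δ - (k - l) * δ = (l + 1) * δ by ring] at hle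

theorem stmt10 (ε g : ℝ) (hε : 0 ≤ ε) (hg : 0 < g) (μB μU : Measure ℝ)
    [IsProbabilityMeasure μB] [IsProbabilityMeasure μU]
    (h : OSIndist ε g μB μU) (i : ℕ) (hi : 0 < i) :
    OSIndist ε g (pcApprox g i μB) (pcApprox g i μU) := by
  refine ⟨pcApprox_Iio_zero g i μB, pcApprox_Iio_zero g i μU, fun S hS t₀ ht₀ => ?_⟩
  have hS' : MeasurableSet ((· + t₀) ⁻¹' S) := measurable_add_const t₀ hS
  rw [pcApprox_apply g i μB hS, pcApprox_apply g i μU hS', ← lintegral_indicator hS,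
    ← lintegral_add_right_eq_self _ t₀, ← lintegral_const_mul' _ _ ENNReal.ofReal_ne_top,
    ← lintegral_indicator hS']
  refine lintegral_mono fun t => ?_
  by_cases ht : t + t₀ ∈ S
  · simpa [indicator, ht] using pcDensity_le hg h hi ht₀ t
  · simp [indicator, ht]
end

section
/- Let g > 0 and let μ be a Borel probability measure on [0,∞) with finite mean ∫ t dμ(t). For each positive integer i, let μ_i be the piecewise-constant approximation of μ at scale g/i. Then ∫ t dμ_i(t) converges to ∫ t dμ(t) as i → ∞. -/
open MeasureTheory Set Real Filter

lemma mem_Ico_mul_iff_floor_div_eq {h : ℝ} (hh : 0 < h) (s : ℝ) (n : ℤ) :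
    s ∈ Set.Ico ((n : ℝ) * h) (((n : ℝ) + 1) * h) ↔ ⌊s / h⌋ = n := by
  rw [Int.floor_eq_iff, le_div_iff₀ hh, div_lt_iff₀ hh, Set.mem_Ico]

lemma ae_nonneg_of_measure_Iio_zero {μ : Measure ℝ} (hsupp : μ (Set.Iio 0) = 0) :
    ∀ᵐ s ∂μ, 0 ≤ s := by
  filter_upwards [measure_eq_zero_iff_ae_notMem.1 hsupp] with s hs using not_lt.1 hs

lemma measurable_floor_div_add_half_mul (h : ℝ) :
    Measurable fun s : ℝ => ((⌊s / h⌋ : ℝ) + 1 / 2) * h :=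
  (measurable_from_top (f := fun n : ℤ => ((n : ℝ) + 1 / 2) * h)).comp
    (measurable_id.div_const h).floor

lemma lintegral_ofReal_Ico {a b : ℝ} (ha : 0 ≤ a) (hab : a ≤ b) :
    ∫⁻ t in Set.Ico a b, ENNReal.ofReal t = ENNReal.ofReal ((b ^ 2 - a ^ 2) / 2) := by
  rw [← integral_id, intervalIntegral.integral_of_le hab, ← integral_Ico_eq_integral_Ioc,
    ofReal_integral_eq_lintegral_ofReal]
  · exact continuous_id.integrableOn_Icc.mono_set Set.Ico_subset_Icc_self
  · filter_upwards [ae_restrict_mem measurableSet_Ico] with t ht using ha.trans ht.1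

lemma measurable_pcApprox_density (c : ENNReal) (h : ℝ) (μ : Measure ℝ) :
    Measurable fun t : ℝ => if t < 0 then 0 else
      c * μ (Set.Ico ((⌊t / h⌋ : ℝ) * h) (((⌊t / h⌋ : ℝ) + 1) * h)) := by
  refine Measurable.ite measurableSet_Iio measurable_const (Measurable.const_mul ?_ c)
  exact (measurable_from_top (f := fun n : ℤ => μ (Set.Ico ((n : ℝ) * h) (((n : ℝ) + 1) * h)))).comp
    (measurable_id.div_const h).floor

/-- The first moment of the piecewise-constant approximation is the `μ`-integral of the
midpoint of the cell containing the variable. -/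
lemma lintegral_ofReal_pcApprox {g : ℝ} (hg : 0 < g) {i : ℕ} (hi : 0 < i) (μ : Measure ℝ)
    [SFinite μ] (hsupp : μ (Set.Iio 0) = 0) :
    ∫⁻ t, ENNReal.ofReal t ∂(pcApprox g i μ) =
      ∫⁻ s, ENNReal.ofReal (((⌊s / (g / i)⌋ : ℝ) + 1 / 2) * (g / i)) ∂μ := by
  have hh : 0 < g / (i : ℝ) := by positivity
  have hc : (i : ℝ) / g = (g / i)⁻¹ := (inv_div _ _).symm
  rw [pcApprox, lintegral_withDensity_eq_lintegral_mul _
    (measurable_pcApprox_density _ _ μ) ENNReal.measurable_ofReal, hc]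
  generalize g / (i : ℝ) = h at hh
  have hset : MeasurableSet {p : ℝ × ℝ | ⌊p.2 / h⌋ = ⌊p.1 / h⌋} :=
    measurableSet_eq_fun (measurable_snd.div_const h).floor (measurable_fst.div_const h).floor
  have hcell (n : ℤ) : {t : ℝ | ⌊t / h⌋ = n} = Set.Ico ((n : ℝ) * h) (((n : ℝ) + 1) * h) := by
    ext t
    exact (mem_Ico_mul_iff_floor_div_eq hh t n).symm
  have hmeas : Measurable fun p : ℝ × ℝ => ENNReal.ofReal h⁻¹ * ENNReal.ofReal p.1 *
      {p : ℝ × ℝ | ⌊p.2 / h⌋ = ⌊p.1 / h⌋}.indicator 1 p :=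
    (measurable_fst.ennreal_ofReal.const_mul _).mul (measurable_one.indicator hset)
  calc
    _ = ∫⁻ t, ∫⁻ s, ENNReal.ofReal h⁻¹ * ENNReal.ofReal t *
          {p : ℝ × ℝ | ⌊p.2 / h⌋ = ⌊p.1 / h⌋}.indicator 1 (t, s) ∂μ := by
      refine lintegral_congr fun t => ?_
      have hind : (fun s => {p : ℝ × ℝ | ⌊p.2 / h⌋ = ⌊p.1 / h⌋}.indicator
          (1 : ℝ × ℝ → ENNReal) (t, s)) =
          (Set.Ico ((⌊t / h⌋ : ℝ) * h) (((⌊t / h⌋ : ℝ) + 1) * h)).indicator 1 := by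
        rw [← hcell]
        rfl
      rw [lintegral_const_mul _ (by rw [hind]; exact measurable_one.indicator measurableSet_Ico),
        hind, lintegral_indicator_one measurableSet_Ico, Pi.mul_apply]
      split_ifs with ht
      · simp [ENNReal.ofReal_of_nonpos ht.le]
      · ring
    _ = ∫⁻ s, ∫⁻ t, ENNReal.ofReal h⁻¹ * ENNReal.ofReal t *
          {p : ℝ × ℝ | ⌊p.2 / h⌋ = ⌊p.1 / h⌋}.indicator 1 (t, s) ∂volume ∂μ :=
      lintegral_lintegral_swap hmeas.aemeasurable
    _ = _ := by
      have hae : ∀ᵐ s ∂μ, 0 ≤ s := ae_nonneg_of_measure_Iio_zero hsupp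
      refine lintegral_congr_ae ?_
      filter_upwards [hae] with s hs
      have hn : (0 : ℝ) ≤ ⌊s / h⌋ := by exact_mod_cast Int.floor_nonneg.2 (by positivity)
      have hind : (fun t => ENNReal.ofReal h⁻¹ * ENNReal.ofReal t *
          {p : ℝ × ℝ | ⌊p.2 / h⌋ = ⌊p.1 / h⌋}.indicator (1 : ℝ × ℝ → ENNReal) (t, s)) =
          (Set.Ico ((⌊s / h⌋ : ℝ) * h) (((⌊s / h⌋ : ℝ) + 1) * h)).indicator
            fun t => ENNReal.ofReal h⁻¹ * ENNReal.ofReal t := by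
        rw [← hcell]
        ext t
        simp [Set.indicator_apply, eq_comm]
      rw [hind, lintegral_indicator measurableSet_Ico,
        lintegral_const_mul _ ENNReal.measurable_ofReal,
        lintegral_ofReal_Ico (by positivity) (by nlinarith),
        ← ENNReal.ofReal_mul (by positivity)]
      congr 1
      field_simp
      ring

lemma integral_pcApprox {g : ℝ} (hg : 0 < g) {i : ℕ} (hi : 0 < i) (μ : Measure ℝ)
    [SFinite μ] (hsupp : μ (Set.Iio 0) = 0) :
    ∫ t, t ∂(pcApprox g i μ) = ∫ s, ((⌊s / (g / i)⌋ : ℝ) + 1 / 2) * (g / i) ∂μ := by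
  have hh : 0 < g / (i : ℝ) := by positivity
  have hpos : 0 ≤ᵐ[pcApprox g i μ] fun t => t := by
    refine (ae_withDensity_iff (measurable_pcApprox_density _ _ μ)).2 (ae_of_all _ fun t ht => ?_)
    by_contra hneg
    exact ht (if_pos (not_le.1 hneg))
  have hae : ∀ᵐ s ∂μ, 0 ≤ s := ae_nonneg_of_measure_Iio_zero hsupp
  have hmid : 0 ≤ᵐ[μ] fun s => ((⌊s / (g / i)⌋ : ℝ) + 1 / 2) * (g / i) := by
    filter_upwards [hae] with s hs
    have hn : (0 : ℝ) ≤ ⌊s / (g / i)⌋ := by exact_mod_cast Int.floor_nonneg.2 (by positivity)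
    simp only [Pi.zero_apply]
    positivity
  rw [integral_eq_lintegral_of_nonneg_ae hpos measurable_id.aestronglyMeasurable,
    integral_eq_lintegral_of_nonneg_ae hmid
      (measurable_floor_div_add_half_mul _).aestronglyMeasurable, lintegral_ofReal_pcApprox hg hi μ hsupp]

lemma abs_floor_div_add_half_mul_sub_le {h : ℝ} (hh : 0 < h) (s : ℝ) :
    |((⌊s / h⌋ : ℝ) + 1 / 2) * h - s| ≤ h / 2 := by
  have hs := (mem_Ico_mul_iff_floor_div_eq hh s ⌊s / h⌋).2 rfl
  rw [abs_le]
  constructor <;> linarith [hs.1, hs.2]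

theorem stmt11 (g : ℝ) (hg : 0 < g) (μ : Measure ℝ) [IsProbabilityMeasure μ]
    (hsupp : μ (Set.Iio 0) = 0) (hmean : Integrable (fun t => t) μ) :
    Tendsto (fun i : ℕ => ∫ t, t ∂(pcApprox g i μ)) atTop (nhds (∫ t, t ∂μ)) := by
  have hlim : Tendsto (fun i : ℕ => g / (i : ℝ) / 2) atTop (nhds 0) := by
    simpa using (tendsto_const_div_atTop_nhds_zero_nat g).div_const 2
  rw [tendsto_iff_dist_tendsto_zero]
  refine squeeze_zero' (Eventually.of_forall fun _ => dist_nonneg) ?_ hlim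
  filter_upwards [eventually_gt_atTop 0] with i hi
  have hh : 0 < g / (i : ℝ) := by positivity
  have hbound (s : ℝ) := abs_floor_div_add_half_mul_sub_le hh s
  have hdiff : Integrable (fun s => ((⌊s / (g / i)⌋ : ℝ) + 1 / 2) * (g / i) - s) μ :=
    Integrable.of_bound
      ((measurable_floor_div_add_half_mul _).sub measurable_id).aestronglyMeasurable _ (ae_of_all _ hbound)
  have hmid : Integrable (fun s => ((⌊s / (g / i)⌋ : ℝ) + 1 / 2) * (g / i)) μ := by
    exact (hdiff.add hmean).congr (ae_of_all _ fun s => sub_add_cancel _ _)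
  rw [integral_pcApprox hg hi μ hsupp, dist_eq_norm, ← integral_sub hmid hmean]
  refine (norm_integral_le_of_norm_le_const (ae_of_all μ hbound)).trans ?_
  simp
end

section
/- (Pareto optimality of the zero-inflated uniform pairs.) Let ε > 0, g > 0, and let (μ_B, μ_U) be any (ε, g)-one-sided indistinguishable pair of Borel probability measures supported on [0,∞) with finite means. Then there exists η ∈ (e^{−ε}, 1] such that, with M = η·g/(η − e^{−ε}), the pair consisting of Unif(g, M) and the zero-inflated uniform distribution (1−η)·δ₀ + η·Unif(0, M) weakly dominates (μ_B, μ_U) in expected delay: (g + M)/2 ≤ ∫ t dμ_B(t) and η·M/2 ≤ ∫ t dμ_U(t). -/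
open MeasureTheory Set Real

namespace OSIndist

variable {ε g : ℝ} {μB μU : Measure ℝ}

lemma map_sub_le (h : OSIndist ε g μB μU) {t : ℝ} (ht : t ∈ Icc 0 g) :
    μB.map (· - t) ≤ ENNReal.ofReal (exp ε) • μU := by
  refine Measure.le_iff.2 fun S hS => ?_
  have hm : Measurable fun b : ℝ => b - t := by fun_prop
  rw [Measure.map_apply hm hS, Measure.smul_apply, smul_eq_mul]
  refine (h.2.2 _ (hm hS) t ht).trans_eq ?_
  simp [← preimage_comp, Function.comp_def]

lemma ae_nonneg (h : OSIndist ε g μB μU) : ∀ᵐ u ∂μU, 0 ≤ u := by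
  rw [ae_iff]
  simpa [Iio] using h.2.1

lemma integrable_comp_sub (h : OSIndist ε g μB μU) {t : ℝ} (ht : t ∈ Icc 0 g) {φ : ℝ → ℝ}
    (hφ : Integrable φ μU) : Integrable (fun b => φ (b - t)) μB := by
  have hi : Integrable φ (μB.map (· - t)) :=
    (hφ.smul_measure ENNReal.ofReal_ne_top).mono_measure (h.map_sub_le ht)
  exact (integrable_map_measure hi.1 (by fun_prop)).1 hi

lemma setIntegral_comp_sub_le (h : OSIndist ε g μB μU) {t : ℝ} (ht : t ∈ Icc 0 g) {φ : ℝ → ℝ}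
    (hφ : Integrable φ μU) (hφ0 : ∀ u, 0 ≤ u → 0 ≤ φ u) {A : Set ℝ} (hA : MeasurableSet A) :
    exp (-ε) * ∫ b in (· - t) ⁻¹' A, φ (b - t) ∂μB ≤ ∫ u in A, φ u ∂μU := by
  have hi := hφ.smul_measure (c := ENNReal.ofReal (exp ε)) ENNReal.ofReal_ne_top
  have hle := h.map_sub_le ht
  have hnn : ∀ᵐ u ∂(ENNReal.ofReal (exp ε) • μU), 0 ≤ φ u :=
    Measure.smul_absolutelyContinuous.ae_le (h.ae_nonneg.mono fun u hu => hφ0 u hu)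
  have key := integral_mono_measure (Measure.restrict_mono (le_refl A) hle)
    (ae_restrict_of_ae hnn) hi.integrableOn
  rw [setIntegral_map hA (hi.mono_measure hle).1 (by fun_prop), Measure.restrict_smul,
    integral_smul_measure, ENNReal.toReal_ofReal (exp_pos ε).le, smul_eq_mul] at key
  calc exp (-ε) * ∫ b in (· - t) ⁻¹' A, φ (b - t) ∂μB
      ≤ exp (-ε) * (exp ε * ∫ u in A, φ u ∂μU) := by gcongr
    _ = ∫ u in A, φ u ∂μU := by rw [← mul_assoc, ← exp_add]; simp

lemma mul_le_setIntegral_Ico [IsFiniteMeasure μB] (h : OSIndist ε g μB μU) {φ : ℝ → ℝ}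
    (hφ : Integrable φ μU) (hφ0 : ∀ u, 0 ≤ u → 0 ≤ φ u) (hmono : Monotone φ) {x t δ : ℝ}
    (ht : t ∈ Icc 0 g) :
    exp (-ε) * (μB.real (Ico x (x + δ)) * φ (x - t)) ≤
      ∫ u in Ico (x - t) (x - t + δ), φ u ∂μU := by
  refine le_trans ?_ (h.setIntegral_comp_sub_le ht hφ hφ0 measurableSet_Ico)
  have hpre : (· - t) ⁻¹' Ico (x - t) (x - t + δ) = Ico x (x + δ) := by
    ext b
    simp only [mem_preimage, mem_Ico]
    constructor <;> rintro ⟨h1, h2⟩ <;> constructor <;> linarith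
  rw [hpre]
  gcongr
  rw [← smul_eq_mul, ← setIntegral_const]
  exact setIntegral_mono_on (integrable_const _).integrableOn
    (h.integrable_comp_sub ht hφ).integrableOn measurableSet_Ico
    fun b hb => hmono (by linarith [hb.1])

lemma mul_sum_le_setIntegral_Ico [IsFiniteMeasure μB] (h : OSIndist ε g μB μU) {φ : ℝ → ℝ}
    (hφ : Integrable φ μU) (hφ0 : ∀ u, 0 ≤ u → 0 ≤ φ u) (hmono : Monotone φ) {x δ : ℝ}
    (hδ : 0 ≤ δ) (k : ℕ) (hk : k * δ ≤ g) :
    exp (-ε) * (μB.real (Ico x (x + δ)) * ∑ i ∈ Finset.range k, φ (x - (i + 1) * δ)) ≤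
      ∫ u in Ico (x - k * δ) x, φ u ∂μU := by
  induction k with
  | zero => simp
  | succ k ih =>
    push_cast at hk ⊢
    have h0 : 0 ≤ k * δ := by positivity
    have ih := ih (by linarith)
    have ht : ((k : ℝ) + 1) * δ ∈ Icc 0 g := ⟨by positivity, hk⟩
    have htile := h.mul_le_setIntegral_Ico hφ hφ0 hmono (x := x) (δ := δ) ht
    have he : x - ((k : ℝ) + 1) * δ + δ = x - k * δ := by ring
    rw [he] at htile
    rw [← Ico_union_Ico_eq_Ico (a := x - ((k : ℝ) + 1) * δ) (b := x - k * δ) (c := x)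
        (by linarith) (by linarith),
      setIntegral_union (Ico_disjoint_Ico_same) measurableSet_Ico hφ.integrableOn hφ.integrableOn,
      Finset.sum_range_succ]
    linarith

lemma le_integral [IsFiniteMeasure μB] (h : OSIndist ε g μB μU) (hg : 0 < g) {φ : ℝ → ℝ}
    (hφ : Integrable φ μU) (hφ0 : ∀ u, 0 ≤ u → 0 ≤ φ u) (hmono : Monotone φ) (x : ℝ)
    {n : ℕ} (hn : 0 < n) :
    exp (-ε) * ((∫ b in Iio x, φ (b - g) ∂μB) + (∫ b in Ici x, φ b ∂μB) +
      μB.real (Ico x (x + g / n)) * ∑ i ∈ Finset.range n, φ (x - (i + 1) * (g / n))) ≤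
      ∫ u, φ u ∂μU := by
  have hn' : (0 : ℝ) < n := by exact_mod_cast hn
  have hng : n * (g / n) = g := by field_simp
  have h1 := h.setIntegral_comp_sub_le (t := g) ⟨hg.le, le_rfl⟩ hφ hφ0
    (measurableSet_Iio (a := x - g))
  have h2 := h.setIntegral_comp_sub_le (t := 0) ⟨le_rfl, hg.le⟩ hφ hφ0 (measurableSet_Ici (a := x))
  have h3 := h.mul_sum_le_setIntegral_Ico hφ hφ0 hmono (x := x) (δ := g / n) (by positivity) n
    hng.le
  have hpre : (· - g) ⁻¹' Iio (x - g) = Iio x := by ext; simp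
  rw [hpre] at h1
  simp only [sub_zero, preimage_id'] at h2
  rw [hng] at h3
  have hu : ∫ u, φ u ∂μU = (∫ u in Iio (x - g), φ u ∂μU) + (∫ u in Ico (x - g) x, φ u ∂μU) +
      ∫ u in Ici x, φ u ∂μU := by
    rw [← setIntegral_union _ measurableSet_Ico hφ.integrableOn hφ.integrableOn,
      Iio_union_Ico_eq_Iio (by linarith), ← compl_Iio,
      integral_add_compl measurableSet_Iio hφ]
    exact disjoint_left.2 fun u hu hu' => not_lt.2 hu'.1 hu
  rw [hu]
  linarith

lemma measure_Iio_eq_zero (h : OSIndist ε g μB μU) (hg : 0 < g) : μB (Iio g) = 0 := by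
  have h1 := h.2.2 (Iio g) measurableSet_Iio g ⟨hg.le, le_rfl⟩
  have hpre : (· + g) ⁻¹' Iio g = Iio 0 := by ext; simp
  rw [hpre, h.2.1] at h1
  simpa using h1

/-- The mass bound: `μB` has density at most `(exp ε - 1) / g` at scale `g / n`. -/
lemma exp_mul_one_add_le [IsProbabilityMeasure μB] [IsProbabilityMeasure μU]
    (h : OSIndist ε g μB μU) (hg : 0 < g) (x : ℝ) {n : ℕ} (hn : 0 < n) :
    exp (-ε) * (1 + μB.real (Ico x (x + g / n)) * n) ≤ 1 := by
  have h1 := h.le_integral hg (φ := fun _ => 1) (integrable_const _) (fun _ _ => zero_le_one)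
    monotone_const x hn
  have h2 : μB.real (Iio x) + μB.real (Ici x) = 1 := by
    rw [← compl_Iio, measureReal_add_measureReal_compl measurableSet_Iio]; simp
  simpa [h2] using h1

lemma le_integral_id [IsProbabilityMeasure μB] [IsProbabilityMeasure μU]
    (h : OSIndist ε g μB μU) (hg : 0 < g)
    (hB : Integrable (fun t => t) μB) (hU : Integrable (fun t => t) μU)
    (x : ℝ) {n : ℕ} (hn : 0 < n) :
    exp (-ε) * ((∫ b, b ∂μB) - g * μB.real (Iio x) +
      μB.real (Ico x (x + g / n)) * (n * x - g * (n + 1) / 2)) ≤ ∫ u, u ∂μU := by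
  have h1 := h.le_integral hg (φ := fun u => u) hU (fun _ h => h) monotone_id x hn
  have hn' : (0 : ℝ) < n := by exact_mod_cast hn
  have hs : ∀ m : ℕ, ∑ i ∈ Finset.range m, (x - ((i : ℝ) + 1) * (g / n)) =
      m * x - (g / n) * (m * (m + 1) / 2) := by
    intro m
    induction m with
    | zero => simp
    | succ m ih => rw [Finset.sum_range_succ, ih]; push_cast; ring
  have he : g / n * (n * (n + 1) / 2) = g * ((n : ℝ) + 1) / 2 := by field_simp
  have h2 : ∫ b in Iio x, (b - g) ∂μB = (∫ b in Iio x, b ∂μB) - g * μB.real (Iio x) := by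
    rw [integral_sub hB.integrableOn (integrable_const _).integrableOn, setIntegral_const,
      smul_eq_mul, mul_comm]
  have h3 := integral_add_compl (measurableSet_Iio (a := x)) hB
  rw [compl_Iio] at h3
  rw [hs, he, h2] at h1
  rw [← h3]
  convert h1 using 2
  ring

end OSIndist

lemma measureReal_Ico_nat_mul_le {μ : Measure ℝ} [IsFiniteMeasure μ] {δ d : ℝ} (hδ : 0 ≤ δ)
    (hd : ∀ y, μ.real (Ico y (y + δ)) ≤ d) (a : ℝ) (k : ℕ) :
    μ.real (Ico a (a + k * δ)) ≤ k * d := by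
  induction k with
  | zero => simp
  | succ k ih =>
    have h0 : 0 ≤ k * δ := by positivity
    have he : a + ((k + 1 : ℕ) : ℝ) * δ = a + k * δ + δ := by push_cast; ring
    rw [he, ← Ico_union_Ico_eq_Ico (b := a + k * δ) (by linarith) (by linarith)]
    refine (measureReal_union_le _ _).trans ?_
    push_cast
    linarith [hd (a + k * δ)]

lemma measureReal_Ico_le_of_scales {μ : Measure ℝ} [IsFiniteMeasure μ] {g c : ℝ} (hg : 0 < g)
    (hc : 0 ≤ c) (h : ∀ (x : ℝ) (n : ℕ), 0 < n → μ.real (Ico x (x + g / n)) ≤ c * (g / n))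
    {a b : ℝ} (hab : a ≤ b) : μ.real (Ico a b) ≤ c * (b - a) := by
  have hn : ∀ n : ℕ, μ.real (Ico a b) ≤ c * (b - a) + c * g * (1 / ((n : ℝ) + 1)) := by
    intro n
    have hδ : 0 < g / ((n + 1 : ℕ) : ℝ) := by positivity
    set δ := g / ((n + 1 : ℕ) : ℝ) with hδd
    have h1 := measureReal_Ico_nat_mul_le hδ.le (fun y => h y (n + 1) n.succ_pos) a ⌈(b - a) / δ⌉₊
    have h2 := Nat.le_ceil ((b - a) / δ)
    have h3 := Nat.ceil_lt_add_one (a := (b - a) / δ) (div_nonneg (by linarith) hδ.le)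
    rw [div_le_iff₀ hδ] at h2
    have h4 : (⌈(b - a) / δ⌉₊ : ℝ) * δ ≤ b - a + δ := by
      calc _ ≤ ((b - a) / δ + 1) * δ := by gcongr
        _ = _ := by field_simp
    calc μ.real (Ico a b) ≤ μ.real (Ico a (a + ⌈(b - a) / δ⌉₊ * δ)) :=
          measureReal_mono (Ico_subset_Ico_right (by linarith))
      _ ≤ c * (⌈(b - a) / δ⌉₊ * δ) := h1.trans_eq (by ring)
      _ ≤ c * (b - a + δ) := by gcongr
      _ = _ := by rw [hδd]; push_cast; ring
  refine ge_of_tendsto' (x := Filter.atTop) ?_ hn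
  simpa using (tendsto_one_div_add_atTop_nhds_zero_nat.const_mul (c * g)).const_add (c * (b - a))

/-- A probability measure on `[g, ∞)` with density at most `c` has mean at least that of the
uniform distribution on `[g, g + 1 / c]`. -/
lemma le_integral_id_of_measureReal_Iio_le {μ : Measure ℝ} [IsProbabilityMeasure μ] {g c : ℝ}
    (hg : 0 < g) (hc : 0 < c) (hμ : ∀ x, μ.real (Iio x) ≤ c * max (x - g) 0)
    (hint : Integrable (fun t => t) μ) : g + 1 / (2 * c) ≤ ∫ t, t ∂μ := by
  have hnn : 0 ≤ᵐ[μ] fun t : ℝ => t := by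
    have h0 := hμ 0
    rw [max_eq_right (by linarith), mul_zero] at h0
    have h1 : μ (Iio 0) = 0 := by
      rw [← measureReal_eq_zero_iff]
      exact le_antisymm h0 measureReal_nonneg
    change ∀ᵐ t ∂μ, 0 ≤ t
    rw [ae_iff]
    simpa [Iio] using h1
  have hm : g < g + 1 / c := by have := one_div_pos.2 hc; linarith
  have hcont : Continuous fun t : ℝ => 1 - c * max (t - g) 0 := by fun_prop
  have htail : ∀ t, ENNReal.ofReal (1 - c * max (t - g) 0) ≤ μ {a | t ≤ a} := by
    intro t
    rw [← ofReal_measureReal]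
    apply ENNReal.ofReal_le_ofReal
    have h2 : μ.real (Iio t) + μ.real (Ici t) = 1 := by
      rw [← compl_Iio, measureReal_add_measureReal_compl measurableSet_Iio]; simp
    change _ ≤ μ.real (Ici t)
    linarith [hμ t]
  have hval : ∫ t in (0 : ℝ)..(g + 1 / c), (1 - c * max (t - g) 0) = g + 1 / (2 * c) := by
    rw [← intervalIntegral.integral_add_adjacent_intervals (b := g)
      (hcont.intervalIntegrable _ _) (hcont.intervalIntegrable _ _)]
    have e1 : ∫ t in (0 : ℝ)..g, (1 - c * max (t - g) 0) = ∫ t in (0 : ℝ)..g, (1 : ℝ) := by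
      refine intervalIntegral.integral_congr fun t ht => ?_
      rw [uIcc_of_le hg.le] at ht
      simp [max_eq_right (sub_nonpos.2 ht.2)]
    have e2 : ∫ t in g..(g + 1 / c), (1 - c * max (t - g) 0) =
        ∫ t in g..(g + 1 / c), (1 - c * (t - g)) := by
      refine intervalIntegral.integral_congr fun t ht => ?_
      rw [uIcc_of_le hm.le] at ht
      simp [max_eq_left (sub_nonneg.2 ht.1)]
    have e3 := intervalIntegral.integral_comp_sub_right (fun s : ℝ => 1 - c * s)
      (a := g) (b := g + 1 / c) g
    rw [e1, e2, e3, intervalIntegral.integral_sub (by simp)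
      (Continuous.intervalIntegrable (by fun_prop) _ _),
      intervalIntegral.integral_const_mul, integral_id]
    simp
    field_simp
    ring
  have hint0 : 0 ≤ ∫ t, t ∂μ := integral_nonneg_of_ae hnn
  rw [← ENNReal.ofReal_le_ofReal_iff hint0, ofReal_integral_eq_lintegral_ofReal hint hnn,
    lintegral_eq_lintegral_meas_le μ hnn hint.aemeasurable, ← hval,
    intervalIntegral.integral_of_le (by linarith), ofReal_integral_eq_lintegral_ofReal
      (hcont.integrableOn_Ioc)]
  · exact (lintegral_mono htail).trans (lintegral_mono_set Ioc_subset_Ioi_self)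
  · filter_upwards [ae_restrict_mem measurableSet_Ioc] with t ht
    have : max (t - g) 0 ≤ 1 / c := max_le (by linarith [ht.2]) (one_div_pos.2 hc).le
    have := mul_le_mul_of_nonneg_left this hc.le
    rw [mul_one_div_cancel hc.ne'] at this
    simp only [Pi.zero_apply]
    linarith

lemma exists_scale_density {μ : Measure ℝ} [IsProbabilityMeasure μ] {g K : ℝ} (hg : 0 < g)
    (hK : ∀ (x : ℝ) (n : ℕ), 0 < n → μ.real (Ico x (x + g / n)) ≤ K * (g / n)) :
    ∃ c, 0 < c ∧ c ≤ K ∧ (∀ a b, a ≤ b → μ.real (Ico a b) ≤ c * (b - a)) ∧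
      ∀ δ > 0, ∃ (x : ℝ) (n : ℕ), 0 < n ∧ g / n < δ ∧
        (c - δ) * (g / n) < μ.real (Ico x (x + g / n)) := by
  set R : Set ℝ := {r | ∃ (x : ℝ) (n : ℕ), 0 < n ∧ r = μ.real (Ico x (x + g / n)) / (g / n)} with hR
  have hpos : ∀ n : ℕ, 0 < n → 0 < g / n := fun n hn => by positivity
  have hne : R.Nonempty := ⟨_, 0, 1, one_pos, rfl⟩
  have hub : ∀ r ∈ R, r ≤ K := by
    rintro r ⟨x, n, hn, rfl⟩
    exact (div_le_iff₀ (hpos n hn)).2 (hK x n hn)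
  have hle : ∀ (x : ℝ) (n : ℕ), 0 < n → μ.real (Ico x (x + g / n)) ≤ sSup R * (g / n) :=
    fun x n hn => (div_le_iff₀ (hpos n hn)).1 (le_csSup ⟨K, hub⟩ ⟨x, n, hn, rfl⟩)
  have hc0 : 0 ≤ sSup R := le_csSup_of_le ⟨K, hub⟩ ⟨0, 1, one_pos, rfl⟩
    (div_nonneg measureReal_nonneg (hpos 1 one_pos).le)
  have hlip : ∀ a b, a ≤ b → μ.real (Ico a b) ≤ sSup R * (b - a) :=
    fun a b hab => measureReal_Ico_le_of_scales hg hc0 hle hab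
  refine ⟨sSup R, hc0.lt_of_ne' fun h0 => ?_, csSup_le hne hub, hlip, fun δ hδ => ?_⟩
  · have hz : μ univ = 0 := by
      rw [← iUnion_Ico_intCast ℝ, measure_iUnion_null_iff]
      intro k
      rw [← measureReal_eq_zero_iff]
      have := hlip k (k + 1) (by linarith)
      rw [h0, zero_mul] at this
      exact le_antisymm this measureReal_nonneg
    simp at hz
  · obtain ⟨r, ⟨x, n, hn, rfl⟩, hr⟩ := exists_lt_of_lt_csSup hne (sub_lt_self (sSup R) hδ)
    obtain ⟨N, hN⟩ := exists_nat_gt (g / δ)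
    have hN0 : (0 : ℝ) < N := lt_trans (by positivity) hN
    have hn1 : (1 : ℝ) ≤ n := by exact_mod_cast hn
    have hnN : 0 < n * N := Nat.mul_pos hn (by exact_mod_cast hN0)
    rw [lt_div_iff₀ (hpos n hn)] at hr
    by_contra! hcon
    have hsmall : g / ((n * N : ℕ) : ℝ) < δ := by
      push_cast
      rw [div_lt_iff₀ hδ] at hN
      rw [div_lt_iff₀ (by positivity)]
      nlinarith [mul_pos hN0 hδ]
    have h1 := measureReal_Ico_nat_mul_le (hpos _ hnN).le
      (fun y => hcon y (n * N) hnN hsmall) x N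
    have he : (N : ℝ) * (g / ((n * N : ℕ) : ℝ)) = g / n := by push_cast; field_simp
    rw [mul_left_comm, he] at h1
    linarith

/-- Pareto optimality of the zero-inflated uniform pairs: for any (ε,g)-one-sided
indistinguishable pair with finite means there is η ∈ (e^{−ε},1] such that, with
M = η·g/(η − e^{−ε}), the pair (Unif(g,M), (1−η)·δ₀ + η·Unif(0,M)) — whose means are
(g+M)/2 and η·M/2 — weakly dominates it in expected delay. -/
theorem stmt12 (ε g : ℝ) (hε : 0 < ε) (hg : 0 < g) (μB μU : Measure ℝ)
    [IsProbabilityMeasure μB] [IsProbabilityMeasure μU]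
    (h : OSIndist ε g μB μU)
    (hB : Integrable (fun t => t) μB) (hU : Integrable (fun t => t) μU) :
    ∃ η ∈ Set.Ioc (Real.exp (-ε)) 1,
      (g + η * g / (η - Real.exp (-ε))) / 2 ≤ ∫ t, t ∂μB ∧
      η * (η * g / (η - Real.exp (-ε))) / 2 ≤ ∫ t, t ∂μU := by
  have hexp : exp (-ε) * exp ε = 1 := by rw [← exp_add]; simp
  set q := exp (-ε) with hq
  have hq0 : 0 < q := exp_pos _
  obtain ⟨c, hc, hcK, hlip, happ⟩ := exists_scale_density (μ := μB) (g := g)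
    (K := (1 / q - 1) / g) hg fun x n hn => by
      have h1 := h.exp_mul_one_add_le hg x hn
      have hn' : (0 : ℝ) < n := by exact_mod_cast hn
      rw [← hq, mul_comm, ← le_div_iff₀ hq0] at h1
      have he : (1 / q - 1) / g * (g / n) = (1 / q - 1) / n := by field_simp
      rw [he, le_div_iff₀ hn']
      linarith
  have hIio : ∀ x, μB.real (Iio x) ≤ c * max (x - g) 0 := by
    intro x
    have h0 : μB.real (Iio g) = 0 := by simp [Measure.real, h.measure_Iio_eq_zero hg]
    rcases le_total x g with hx | hx
    · rw [max_eq_right (by linarith), mul_zero, ← h0]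
      exact measureReal_mono (Iio_subset_Iio hx)
    · rw [max_eq_left (by linarith), ← Iio_union_Ico_eq_Iio hx]
      refine (measureReal_union_le _ _).trans ?_
      linarith [hlip g x hx]
  have hmean := le_integral_id_of_measureReal_Iio_le hg hc hIio hB
  have hM : q * (1 + c * g) * g / (q * (1 + c * g) - q) = g + 1 / c := by
    have : q * (1 + c * g) - q = q * (c * g) := by ring
    rw [this]
    field_simp
    ring
  refine ⟨q * (1 + c * g), ⟨?_, ?_⟩, ?_, ?_⟩
  · have := mul_pos hq0 (mul_pos hc hg)
    linarith
  · rw [le_div_iff₀ hg, le_sub_iff_add_le, le_div_iff₀ hq0] at hcK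
    linarith
  · rw [hM]
    refine le_trans (le_of_eq ?_) hmean
    field_simp
    ring
  · rw [hM]
    have hT : q * (1 + c * g) * (g + 1 / c) / 2 = q * (g + 1 / (2 * c) + c * g ^ 2 / 2) := by
      field_simp
      ring
    rw [hT]
    have hδ : ∀ δ > 0, q * (g + 1 / (2 * c) + c * g ^ 2 / 2) -
        δ * (q * (g * (g + 1 / c) + 2 * c * g)) ≤ ∫ t, t ∂μU := by
      intro δ hδ
      obtain ⟨x, n, hn, hsmall, hx⟩ := happ δ hδ
      have hn' : (0 : ℝ) < n := by exact_mod_cast hn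
      have hU' := h.le_integral_id hg hB hU x hn
      refine le_trans ?_ hU'
      rw [mul_left_comm, ← mul_sub]
      gcongr
      have he : 0 < g / n := by positivity
      set e := g / n with he_def
      have hne : (n : ℝ) = g / e := by rw [he_def]; field_simp
      obtain ⟨d, hd⟩ : ∃ d, d = μB.real (Ico x (x + e)) / e := ⟨_, rfl⟩
      have hβ : μB.real (Ico x (x + e)) = d * e := by rw [hd]; field_simp
      have hd0 : 0 ≤ d := hd ▸ div_nonneg measureReal_nonneg he.le
      have hdc : d ≤ c := by
        rw [hd, div_le_iff₀ he]
        linarith [hlip x (x + e) (by linarith)]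
      have hcd : c - δ < d := by rwa [hd, lt_div_iff₀ he]
      have hval : μB.real (Ico x (x + e)) * (n * x - g * (n + 1) / 2) =
          g * (d * x) - d * (g ^ 2 / 2) - g / 2 * (d * e) := by
        rw [hβ, hne]
        field_simp
        ring
      have hde : d * e ≤ c * δ := mul_le_mul hdc hsmall.le he.le hc.le
      have hdg : d * (g ^ 2 / 2) ≤ c * (g ^ 2 / 2) := by gcongr
      have hPx := hIio x
      have hcm : c * (g + 1 / c) = c * g + 1 := by field_simp
      have hgm : g ≤ g + 1 / c := by have := one_div_pos.2 hc; linarith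
      have hpeak : c * g - δ * (g + 1 / c) - c * δ ≤ d * x - μB.real (Iio x) := by
        have hcδ : 0 ≤ c * δ := by positivity
        rcases le_total x g with hxg | hxg
        · rw [max_eq_right (by linarith), mul_zero] at hPx
          have hsup : 0 ≤ d * (x + e - g) := by
            rcases le_total (x + e) g with hxe | hxe
            · have h1 : μB.real (Ico x (x + e)) ≤ μB.real (Iio (x + e)) :=
                measureReal_mono Ico_subset_Iio_self
              have h2 := hIio (x + e)
              rw [max_eq_right (by linarith), mul_zero] at h2
              have h3 : d ≤ 0 := by nlinarith
              simp [le_antisymm h3 hd0]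
            · exact mul_nonneg hd0 (by linarith)
          have h4 : (c - δ) * g ≤ d * g := by gcongr
          have h5 : δ * g ≤ δ * (g + 1 / c) := by gcongr
          linarith
        · rcases le_total x (g + 1 / c) with hxm | hxm
          · rw [max_eq_left (by linarith)] at hPx
            have hx0 : 0 ≤ x := hg.le.trans hxg
            have h4 : (c - δ) * x ≤ d * x := by gcongr
            have h5 : δ * x ≤ δ * (g + 1 / c) := by gcongr
            linarith
          · have h4 : (c - δ) * (g + 1 / c) ≤ d * (g + 1 / c) := by gcongr
            have h5 : d * (g + 1 / c) ≤ d * x := by gcongr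
            have h6 : μB.real (Iio x) ≤ 1 := measureReal_le_one
            linarith
      have hpeak' := mul_le_mul_of_nonneg_left hpeak hg.le
      have hde' := mul_le_mul_of_nonneg_left hde hg.le
      have hcgδ : 0 ≤ g * (c * δ) := by positivity
      rw [hval]
      linarith
    have hK : 0 < q * (g * (g + 1 / c) + 2 * c * g) := by positivity
    refine le_of_forall_pos_le_add fun r hr => ?_
    have := hδ _ (div_pos hr hK)
    rw [div_mul_cancel₀ _ hK.ne'] at this
    linarith
end

section
/- Let ε > 0 and g > 0. For every (ε, g)-one-sided indistinguishable pair (μ_B, μ_U) of Borel probability measures supported on [0,∞), the mean of μ_B satisfies ∫ t dμ_B(t) ≥ (g/2)·(1 + 1/(1 − e^{−ε})). Moreover this bound is attained by the pair (Unif(g, g/(1 − e^{−ε})), Unif(0, g/(1 − e^{−ε}))), so it is the minimum expected batched delay over all (ε,g)-one-sided indistinguishable pairs. -/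
open MeasureTheory Set Real

namespace OSIndist

variable {ε g : ℝ} {μB μU : Measure ℝ}

lemma real_le [IsFiniteMeasure μU] (h : OSIndist ε g μB μU) {S : Set ℝ} (hS : MeasurableSet S)
    {t₀ : ℝ} (ht : t₀ ∈ Icc 0 g) :
    μB.real S ≤ exp ε * μU.real ((· + t₀) ⁻¹' S) := by
  have := ENNReal.toReal_mono
    (ENNReal.mul_ne_top ENNReal.ofReal_ne_top (measure_ne_top μU _)) (h.2.2 S hS t₀ ht)
  rwa [ENNReal.toReal_mul, ENNReal.toReal_ofReal (exp_pos ε).le] at this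

/-- Shifting an interval of length `g / n` by the multiples of `g / n` up to `g` gives `n + 1`
disjoint intervals, on each of which `μU` has at least `exp (-ε)` times the mass of `μB`. -/
lemma real_Ico_le [IsProbabilityMeasure μB] [IsProbabilityMeasure μU]
    (h : OSIndist ε g μB μU) (hg : 0 < g) {n : ℕ} (hn : 0 < n) (x : ℝ) :
    n * μB.real (Ico x (x + g / n)) ≤ exp ε - 1 := by
  have hn' : (0 : ℝ) < n := by exact_mod_cast hn
  set w := g / n with hw
  have hwpos : 0 < w := by positivity
  have hnw : n * w = g := by rw [hw]; field_simp
  have hsplit (μ : Measure ℝ) [IsProbabilityMeasure μ] (a b : ℝ) (hab : a ≤ b) :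
      μ.real (Ici a) = μ.real (Ico a b) + μ.real (Ici b) := by
    rw [← measureReal_union _ measurableSet_Ici, Ico_union_Ici_eq_Ici hab]
    exact disjoint_left.2 fun y hy hy' => absurd hy.2 (not_lt.2 hy')
  have hcompl (μ : Measure ℝ) [IsProbabilityMeasure μ] (a : ℝ) :
      μ.real (Iio a) + μ.real (Ici a) = 1 := by
    rw [← compl_Iio, measureReal_compl measurableSet_Iio]; simp
  have hstep (k : ℕ) (hk : k ≤ n + 1) :
      exp ε * μU.real (Ici (x + w)) + k * μB.real (Ico x (x + w)) ≤
        exp ε * μU.real (Ici (x + w - k * w)) := by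
    induction k with
    | zero => simp
    | succ k ih =>
      have ih := ih (by omega)
      have hkn : (k : ℝ) ≤ n := by exact_mod_cast (by omega : k ≤ n)
      have hshift := h.real_le (S := Ico x (x + w)) measurableSet_Ico
        (t₀ := k * w) ⟨by positivity, by rw [← hnw]; gcongr⟩
      rw [preimage_add_const_Ico] at hshift
      have := hsplit μU (x - k * w) (x + w - k * w) (by linarith)
      push_cast
      rw [show x + w - (k + 1) * w = x - k * w by ring, this]
      linarith
  have hmid := hstep (n + 1) le_rfl
  push_cast at hmid
  rw [show x + w - (n + 1) * w = x - g by linarith] at hmid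
  have hleft := h.real_le (S := Iio x) measurableSet_Iio (t₀ := g) ⟨hg.le, le_rfl⟩
  rw [preimage_add_const_Iio] at hleft
  have hright := h.real_le (S := Ici (x + w)) measurableSet_Ici (t₀ := 0) ⟨le_rfl, hg.le⟩
  simp only [add_zero, preimage_id'] at hright
  have hU := congrArg (exp ε * ·) (hcompl μU (x - g))
  linarith [hcompl μB x, hsplit μB x (x + w) (by linarith)]

lemma real_Iio_self (h : OSIndist ε g μB μU) (hg : 0 < g) : μB.real (Iio g) = 0 := by
  have := h.2.2 (Iio g) measurableSet_Iio g ⟨hg.le, le_rfl⟩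
  rw [preimage_add_const_Iio, sub_self, h.2.1, mul_zero] at this
  simp [Measure.real, le_antisymm this zero_le]

lemma real_Iio_le [IsProbabilityMeasure μB] [IsProbabilityMeasure μU]
    (h : OSIndist ε g μB μU) (hg : 0 < g) {t : ℝ} (ht : g ≤ t) :
    μB.real (Iio t) ≤ (t - g) / g * (exp ε - 1) := by
  have hmul (n : ℕ) (hn : 0 < n) (k : ℕ) :
      n * μB.real (Iio (g + k * (g / n))) ≤ k * (exp ε - 1) := by
    induction k with
    | zero => simp [h.real_Iio_self hg]
    | succ k ih =>
      have hle : μB.real (Iio (g + (k + 1 : ℕ) * (g / n))) ≤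
          μB.real (Iio (g + k * (g / n))) +
            μB.real (Ico (g + k * (g / n)) (g + k * (g / n) + g / n)) := by
        refine (measureReal_mono fun y hy => ?_).trans (measureReal_union_le _ _)
        rw [mem_Iio] at hy
        push_cast at hy
        rcases lt_or_ge y (g + k * (g / n)) with hy' | hy'
        · exact Or.inl hy'
        · exact Or.inr ⟨hy', by linarith⟩
      have hle' := mul_le_mul_of_nonneg_left hle (Nat.cast_nonneg (α := ℝ) n)
      have := h.real_Ico_le hg hn (g + k * (g / n))
      push_cast at hle' ⊢
      linarith
  have happrox (n : ℕ) :
      μB.real (Iio t) ≤ ((t - g) / g + 1 / ((n : ℝ) + 1)) * (exp ε - 1) := by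
    have hexp : 0 ≤ exp ε - 1 :=
      le_trans (by positivity) (h.real_Ico_le hg one_pos g)
    have hn : (0 : ℝ) < (n : ℝ) + 1 := by positivity
    set k := ⌈(t - g) / g * ((n : ℝ) + 1)⌉₊ with hk
    have hk₁ : (t - g) / g * ((n : ℝ) + 1) ≤ k := Nat.le_ceil _
    have hk₂ : (k : ℝ) < (t - g) / g * ((n : ℝ) + 1) + 1 :=
      Nat.ceil_lt_add_one (mul_nonneg (div_nonneg (by linarith) hg.le) hn.le)
    have htk : t ≤ g + k * (g / ((n + 1 : ℕ) : ℝ)) := by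
      have := mul_le_mul_of_nonneg_right hk₁ (div_nonneg hg.le hn.le)
      push_cast
      have he : (t - g) / g * ((n : ℝ) + 1) * (g / ((n : ℝ) + 1)) = t - g := by field_simp
      linarith
    have hmono : μB.real (Iio t) ≤ μB.real (Iio (g + k * (g / ((n + 1 : ℕ) : ℝ)))) :=
      measureReal_mono (Iio_subset_Iio htk)
    have hb := hmul (n + 1) n.succ_pos k
    refine hmono.trans (le_of_mul_le_mul_left (hb.trans ?_)
      (by positivity : (0 : ℝ) < ((n + 1 : ℕ) : ℝ)))
    push_cast
    calc (k : ℝ) * (exp ε - 1) ≤ ((t - g) / g * ((n : ℝ) + 1) + 1) * (exp ε - 1) := by gcongr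
      _ = _ := by field_simp
  have hlim := ((tendsto_one_div_add_atTop_nhds_zero_nat (𝕜 := ℝ)).const_add
    ((t - g) / g)).mul_const (exp ε - 1)
  rw [add_zero] at hlim
  exact ge_of_tendsto' hlim happrox

/-- A lower bound for the mean of `μB`, with `L` the right end point of the optimal interval. -/
lemma ofReal_le_lintegral [IsProbabilityMeasure μB] [IsProbabilityMeasure μU]
    (h : OSIndist ε g μB μU) (hg : 0 < g) {L : ℝ} (hgL : g < L)
    (hL : (L - g) * (exp ε - 1) = g) :
    ENNReal.ofReal ((g + L) / 2) ≤ ∫⁻ t, ENNReal.ofReal t ∂μB := by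
  have hnonneg : 0 ≤ᵐ[μB] fun t : ℝ => t := by
    rw [Filter.EventuallyLE, ae_iff]
    simpa [Iio_def] using h.1
  have htail (t : ℝ) : ENNReal.ofReal (1 - μB.real (Iio t)) = μB {a | t ≤ a} := by
    rw [← probReal_compl_eq_one_sub measurableSet_Iio, compl_Iio, ofReal_measureReal]
    rfl
  have hLpos : 0 < L - g := sub_pos.2 hgL
  rw [lintegral_eq_lintegral_meas_le μB hnonneg aemeasurable_id']
  have hnear : ENNReal.ofReal g ≤ ∫⁻ t in Ioc 0 g, μB {a | t ≤ a} := by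
    calc ENNReal.ofReal g = ∫⁻ _ in Ioc 0 g, 1 := by simp
      _ ≤ _ := by
        refine setLIntegral_mono' measurableSet_Ioc fun t ht => ?_
        have : μB.real (Iio t) ≤ 0 :=
          (measureReal_mono (Iio_subset_Iio ht.2)).trans_eq (h.real_Iio_self hg)
        rw [← htail, ← ENNReal.ofReal_one]
        exact ENNReal.ofReal_le_ofReal (by linarith)
  have hfar : ENNReal.ofReal ((L - g) / 2) ≤ ∫⁻ t in Ioc g L, μB {a | t ≤ a} := by
    have hint : ∫ t in Ioc g L, (L - t) / (L - g) = (L - g) / 2 := by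
      rw [← intervalIntegral.integral_of_le hgL.le, intervalIntegral.integral_div,
        intervalIntegral.integral_sub (by simp) (by simp)]
      simp only [intervalIntegral.integral_const, integral_id, smul_eq_mul]
      field_simp
      ring
    calc ENNReal.ofReal ((L - g) / 2)
        = ∫⁻ t in Ioc g L, ENNReal.ofReal ((L - t) / (L - g)) := by
          rw [← hint, ofReal_integral_eq_lintegral_ofReal]
          · exact (Continuous.integrableOn_Ioc (by fun_prop))
          · refine (ae_restrict_iff' measurableSet_Ioc).2 (.of_forall fun t ht => ?_)
            exact div_nonneg (sub_nonneg.2 ht.2) hLpos.le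
      _ ≤ _ := by
        refine setLIntegral_mono' measurableSet_Ioc fun t ht => ?_
        rw [← htail]
        refine ENNReal.ofReal_le_ofReal ?_
        have hB := h.real_Iio_le hg ht.1.le
        have h₁ : (t - g) / g * (exp ε - 1) = (t - g) / (L - g) := by
          field_simp
          linear_combination (t - g) * hL
        have h₂ : (L - t) / (L - g) = 1 - (t - g) / (L - g) := by field_simp; ring
        linarith
  calc ENNReal.ofReal ((g + L) / 2)
      = ENNReal.ofReal g + ENNReal.ofReal ((L - g) / 2) := by
        rw [← ENNReal.ofReal_add hg.le (by linarith)]; congr 1; ring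
    _ ≤ _ := add_le_add hnear hfar
    _ = ∫⁻ t in Ioc 0 L, μB {a | t ≤ a} := by
        rw [← Ioc_union_Ioc_eq_Ioc hg.le hgL.le, lintegral_union measurableSet_Ioc]
        exact Ioc_disjoint_Ioc_of_le le_rfl
    _ ≤ _ := lintegral_mono_set fun t ht => ht.1

end OSIndist

lemma unif_apply_Iio_zero {a b : ℝ} (ha : 0 ≤ a) : unif a b (Iio 0) = 0 := by
  have : Iio 0 ∩ Icc a b = ∅ := by
    ext y
    simp only [mem_inter_iff, mem_Iio, mem_Icc, mem_empty_iff_false, iff_false]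
    rintro ⟨h₁, h₂, -⟩
    linarith
  simp [unif, Measure.restrict_apply measurableSet_Iio, this]

lemma osIndist_unif {ε g L : ℝ} (hg : 0 < g) (hgL : g < L) (hL : L = exp ε * (L - g)) :
    OSIndist ε g (unif g L) (unif 0 L) := by
  refine ⟨unif_apply_Iio_zero hg.le, unif_apply_Iio_zero le_rfl, fun S hS t₀ ht => ?_⟩
  have hcoef : (ENNReal.ofReal (L - g))⁻¹ =
      ENNReal.ofReal (exp ε) * (ENNReal.ofReal (L - 0))⁻¹ := by
    have hLpos : 0 < L := hg.trans hgL
    rw [sub_zero, ← ENNReal.ofReal_inv_of_pos (sub_pos.2 hgL),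
      ← ENNReal.ofReal_inv_of_pos hLpos, ← ENNReal.ofReal_mul (exp_pos ε).le]
    congr 1
    have : L - g ≠ 0 := (sub_pos.2 hgL).ne'
    field_simp
    linarith
  have hvol : volume (S ∩ Icc g L) ≤ volume ((· + t₀) ⁻¹' S ∩ Icc 0 L) := by
    rw [← measure_preimage_add_right volume t₀ (S ∩ Icc g L)]
    refine measure_mono fun y hy => ⟨hy.1, ?_, ?_⟩
    · linarith [hy.2.1, ht.2]
    · linarith [hy.2.2, ht.1]
  simp only [unif, Measure.smul_apply, smul_eq_mul, Measure.restrict_apply hS,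
    Measure.restrict_apply (measurable_add_const t₀ hS)]
  rw [← mul_assoc, ← hcoef]
  gcongr

lemma lintegral_unif {a b : ℝ} (ha : 0 ≤ a) (hab : a < b) :
    ∫⁻ t, ENNReal.ofReal t ∂(unif a b) = ENNReal.ofReal ((a + b) / 2) := by
  have hint : ∫ t in Icc a b, t = (b ^ 2 - a ^ 2) / 2 := by
    rw [integral_Icc_eq_integral_Ioc, ← intervalIntegral.integral_of_le hab.le, integral_id]
  have hpos : 0 < b - a := sub_pos.2 hab
  rw [unif, lintegral_smul_measure, ← ofReal_integral_eq_lintegral_ofReal, hint, smul_eq_mul,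
    ← ENNReal.ofReal_inv_of_pos hpos, ← ENNReal.ofReal_mul (inv_pos.2 hpos).le]
  · congr 1
    field_simp
    ring
  · exact Continuous.integrableOn_Icc continuous_id
  · exact (ae_restrict_iff' measurableSet_Icc).2 (.of_forall fun t ht => ha.trans ht.1)

theorem stmt13 (ε g : ℝ) (hε : 0 < ε) (hg : 0 < g) :
    (∀ μB μU : Measure ℝ, IsProbabilityMeasure μB → IsProbabilityMeasure μU →
      OSIndist ε g μB μU →
      ENNReal.ofReal ((g / 2) * (1 + 1 / (1 - Real.exp (-ε)))) ≤
        ∫⁻ t, ENNReal.ofReal t ∂μB) ∧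
    OSIndist ε g (unif g (g / (1 - Real.exp (-ε)))) (unif 0 (g / (1 - Real.exp (-ε)))) ∧
    (∫⁻ t, ENNReal.ofReal t ∂(unif g (g / (1 - Real.exp (-ε))))) =
      ENNReal.ofReal ((g / 2) * (1 + 1 / (1 - Real.exp (-ε)))) := by
  have hlt : exp (-ε) < 1 := by simpa using hε
  have hpos : 0 < 1 - exp (-ε) := by linarith
  have hexp : exp ε * exp (-ε) = 1 := by rw [← exp_add]; simp
  set L := g / (1 - exp (-ε)) with hLdef
  have hLg : L * (1 - exp (-ε)) = g := by rw [hLdef]; field_simp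
  have hLpos : 0 < L := by positivity
  have hL : L = exp ε * (L - g) := by linear_combination -L * hexp - exp ε * hLg
  have hgL : g < L := by nlinarith [mul_pos hLpos (exp_pos (-ε))]
  have hmean : g / 2 * (1 + 1 / (1 - exp (-ε))) = (g + L) / 2 := by rw [hLdef]; ring
  rw [hmean]
  exact ⟨fun μB μU _ _ h => h.ofReal_le_lintegral hg hgL (by linarith),
    osIndist_unif hg hgL hL, lintegral_unif hg.le hgL⟩
end

section
/- Let ε ≥ 0 and g > 0, and let (μ_B, μ_U) be a pair of Borel probability measures, each giving measure zero to (−∞,0), that satisfies the (ε,g)-product condition. Suppose moreover that μ_U = p·δ₀ + ν for some p ∈ [0,1] and some measure ν that is absolutely continuous with respect to Lebesgue measure with a density u that is nonincreasing on [0,∞) (and zero on (−∞,0)). Then (μ_B, μ_U) is (ε/2, g)-one-sided indistinguishable. -/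
open MeasureTheory Set Real
open scoped ENNReal

/-- If `u` is nonincreasing on `[0, ∞)`, translating a set `S ⊆ [t, ∞)` to the left by `t ≥ 0` does
not decrease its measure with respect to `u`. -/
lemma withDensity_le_preimage_add {u : ℝ → ℝ≥0∞}
    (hu : ∀ s t : ℝ, 0 ≤ s → s ≤ t → u t ≤ u s) {S : Set ℝ} (hS : MeasurableSet S) {t : ℝ}
    (ht : 0 ≤ t) (hSt : S ⊆ Ici t) :
    volume.withDensity u S ≤ volume.withDensity u ((· + t) ⁻¹' S) := by
  have hS' : MeasurableSet ((· + t) ⁻¹' S) := measurable_add_const t hS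
  rw [withDensity_apply _ hS, withDensity_apply _ hS', ← lintegral_indicator hS,
    ← lintegral_indicator hS', ← lintegral_add_right_eq_self _ t]
  refine lintegral_mono fun y => ?_
  by_cases hy : y + t ∈ S
  · have hy0 : t ≤ y + t := hSt hy
    rw [indicator_of_mem hy, indicator_of_mem (show y ∈ (· + t) ⁻¹' S from hy)]
    exact hu y (y + t) (by linarith) (by linarith)
  · simp [indicator_of_notMem hy]

lemma dirac_zero_le_preimage_add {S : Set ℝ} (hS : MeasurableSet S) {t : ℝ}
    (ht : 0 ≤ t) (hSt : S ⊆ Ici t) :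
    Measure.dirac (0 : ℝ) S ≤ Measure.dirac (0 : ℝ) ((· + t) ⁻¹' S) := by
  rw [Measure.dirac_apply' _ hS, Measure.dirac_apply' _ (measurable_add_const t hS)]
  by_cases h0 : (0 : ℝ) ∈ S
  · obtain rfl : t = 0 := le_antisymm (hSt h0) ht
    simp
  · simp [indicator_of_notMem h0]

lemma ProdCond.measure_Iio_eq_zero {ε g : ℝ} {μB μU : Measure ℝ} (h : ProdCond ε g μB μU)
    {t : ℝ} (ht : t ∈ Icc 0 g) : μB (Iio t) = 0 := by
  have hpre : (· + t) ⁻¹' Iio t = Iio (0 : ℝ) := by ext; simp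
  have hle := h.2.2 (Iio t) (Iio t) measurableSet_Iio measurableSet_Iio t ht
  rw [hpre, h.2.1, mul_zero, mul_zero] at hle
  exact mul_self_eq_zero.mp (le_antisymm hle zero_le)

theorem stmt15 (ε g : ℝ) (hε : 0 ≤ ε) (hg : 0 < g) (μB μU : Measure ℝ)
    [IsProbabilityMeasure μB] [IsProbabilityMeasure μU]
    (h : ProdCond ε g μB μU)
    (p : ℝ) (hp : p ∈ Set.Icc (0 : ℝ) 1) (u : ℝ → ℝ≥0∞)
    (hu_mono : ∀ s t : ℝ, 0 ≤ s → s ≤ t → u t ≤ u s)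
    (hu_neg : ∀ t : ℝ, t < 0 → u t = 0)
    (hμU : μU = ENNReal.ofReal p • Measure.dirac (0 : ℝ) + volume.withDensity u) :
    OSIndist (ε / 2) g μB μU := by
  refine ⟨h.1, h.2.1, fun S hS t ht => ?_⟩
  set T := S ∩ Ici t
  have hTm : MeasurableSet T := hS.inter measurableSet_Ici
  have hTt : T ⊆ Ici t := inter_subset_right
  have hST : μB S ≤ μB T := by
    calc μB S ≤ μB (T ∪ Iio t) := measure_mono fun x hx => by
          rcases lt_or_ge x t with hxt | hxt
          exacts [Or.inr hxt, Or.inl ⟨hx, hxt⟩]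
      _ ≤ μB T + μB (Iio t) := measure_union_le _ _
      _ = μB T := by rw [h.measure_Iio_eq_zero ht, add_zero]
  have hU : μU T ≤ μU ((· + t) ⁻¹' T) := by
    simp only [hμU, Measure.add_apply, Measure.smul_apply, smul_eq_mul]
    exact add_le_add (mul_le_mul_right (dirac_zero_le_preimage_add hTm ht.1 hTt) _)
      (withDensity_le_preimage_add hu_mono hTm ht.1 hTt)
  have hexp : ENNReal.ofReal (Real.exp ε)
      = ENNReal.ofReal (Real.exp (ε / 2)) * ENNReal.ofReal (Real.exp (ε / 2)) := by
    rw [← ENNReal.ofReal_mul (Real.exp_nonneg _), ← Real.exp_add, add_halves]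
  have hsq : μB T ^ 2 ≤ (ENNReal.ofReal (Real.exp (ε / 2)) * μU ((· + t) ⁻¹' T)) ^ 2 :=
    calc μB T ^ 2 = μB T * μB T := sq _
      _ ≤ ENNReal.ofReal (Real.exp ε) * (μU T * μU ((· + t) ⁻¹' T)) := h.2.2 T T hTm hTm t ht
      _ ≤ ENNReal.ofReal (Real.exp ε) * (μU ((· + t) ⁻¹' T) * μU ((· + t) ⁻¹' T)) := by gcongr
      _ = _ := by rw [hexp]; ring
  calc μB S ≤ μB T := hST
    _ ≤ ENNReal.ofReal (Real.exp (ε / 2)) * μU ((· + t) ⁻¹' T) :=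
        (ENNReal.pow_le_pow_left_iff two_ne_zero).mp hsq
    _ ≤ _ := by
        gcongr
        exact inter_subset_left
end

section
/- (Zero-inflated uniform noise strictly beats exponential noise.) For every ε > 0 and g > 0 there exists η ∈ (e^{−ε}, 1] such that, with M = η·g/(η − e^{−ε}), the means of the zero-inflated uniform pair are strictly smaller than the means of the exponential pair at the same privacy level: (g + M)/2 < g·(1 + 1/ε) and η·M/2 < g/ε. That is, the pair (Unif(g, M), (1−η)·δ₀ + η·Unif(0, M)) achieves strictly lower expected delay for both batched and unbatched comments than the pair (g + Exp(ε/g), Exp(ε/g)). -/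
open Real

theorem zeroInflated_means_lt {ε g q η : ℝ} (hε : 0 < ε) (hg : 0 < g) (hq : q < η)
    (h₁ : q * (1 + ε / 2) < η) (h₂ : ε * η ^ 2 + 2 * q < 2 * η) :
    (g + η * g / (η - q)) / 2 < g * (1 + 1 / ε) ∧
      η * (η * g / (η - q)) / 2 < g / ε := by
  have hd : 0 < η - q := sub_pos.mpr hq
  have key₁ : η / (η - q) < 1 + 2 / ε := by
    have : 1 + 2 / ε = (ε + 2) / ε := by field_simp
    rw [this, div_lt_div_iff₀ hd hε]
    nlinarith
  have key₂ : η ^ 2 / (η - q) < 2 / ε := by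
    rw [div_lt_div_iff₀ hd hε]
    nlinarith
  constructor
  · calc (g + η * g / (η - q)) / 2 = g / 2 * (1 + η / (η - q)) := by ring
      _ < g / 2 * (1 + (1 + 2 / ε)) := by gcongr
      _ = g * (1 + 1 / ε) := by ring
  · calc η * (η * g / (η - q)) / 2 = g / 2 * (η ^ 2 / (η - q)) := by ring
      _ < g / 2 * (2 / ε) := by gcongr
      _ = g / ε := by ring

/-- Zero-inflated uniform noise strictly beats exponential noise: for every ε > 0 and
g > 0 there is η ∈ (e^{−ε},1] such that, with M = η·g/(η − e^{−ε}), the means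
(g + M)/2 and η·M/2 of the pair (Unif(g,M), (1−η)·δ₀ + η·Unif(0,M)) are strictly
smaller than the means g·(1 + 1/ε) and g/ε of the pair (g + Exp(ε/g), Exp(ε/g)). -/
theorem stmt18 (ε g : ℝ) (hε : 0 < ε) (hg : 0 < g) :
    ∃ η ∈ Set.Ioc (Real.exp (-ε)) 1,
      (g + η * g / (η - Real.exp (-ε))) / 2 < g * (1 + 1 / ε) ∧
      η * (η * g / (η - Real.exp (-ε))) / 2 < g / ε := by
  have hE : 1 + ε + ε ^ 2 / 2 ≤ Real.exp ε := Real.quadratic_le_exp_of_nonneg hε.le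
  have hE₀ : 0 < Real.exp ε := Real.exp_pos ε
  rw [Real.exp_neg]
  rcases lt_or_ge ε 1 with h | h
  · have hq : (Real.exp ε)⁻¹ < 1 := inv_lt_one_of_one_lt₀ (by nlinarith)
    refine ⟨1, ⟨hq, le_rfl⟩, zeroInflated_means_lt hε hg hq ?_ ?_⟩
    · rw [inv_mul_lt_iff₀ hE₀]
      nlinarith
    · have : (Real.exp ε)⁻¹ < 1 - ε / 2 := by
        have hε₃ : ε ^ 3 < ε := by nlinarith [mul_pos hε hε]
        rw [inv_lt_iff_one_lt_mul₀ hE₀]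
        nlinarith [mul_le_mul_of_nonneg_left hE (by linarith : (0 : ℝ) ≤ 1 - ε / 2)]
      linarith
  · have hq : (Real.exp ε)⁻¹ < 1 / ε := by
      rw [one_div]
      exact inv_strictAnti₀ hε (by nlinarith)
    refine ⟨1 / ε, ⟨hq, by rwa [div_le_one hε]⟩, zeroInflated_means_lt hε hg hq ?_ ?_⟩
    · rw [inv_mul_lt_iff₀ hE₀, mul_one_div, lt_div_iff₀ hε]
      nlinarith
    · have hq₂ : 2 * (Real.exp ε)⁻¹ < 1 / ε := by
        rw [← div_eq_mul_inv, div_lt_div_iff₀ hE₀ hε]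
        nlinarith [sq_nonneg (ε - 1)]
      have : ε * (1 / ε) ^ 2 = 1 / ε := by field_simp
      linarith
end
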